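/- Let V = [p, k, j, ε] with 1 ≤ j ≤ 2k−1 and ε ∈ F_p^*, and set V* = [p, k, 2k−j, ε^{−1}]. Then we have the polynomial identity X^{p+1}·H(V)(1/X) = ε·(−1)^{j−1}·H(V*)(X) in F_p[T][X]. -/

import Mathlib

open Polynomial

noncomputable section

/-- The continuant of a finite word: `⟨∅⟩ = 1`, `⟨u₁⟩ = u₁`, and
`⟨u₁,…,uₘ⟩ = uₘ·⟨u₁,…,u_{m-1}⟩ + ⟨u₁,…,u_{m-2}⟩`. -/
def cont {R : Type*} [CommRing R] (l : List R) : R :=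
  (l.foldl (fun q a => (a * q.1 + q.2, q.1)) ((1 : R), (0 : R))).1


theorem neg_one_aux {R : Type*} [CommRing R] (i m n : ℕ) (h : i + m = 2 * n) :
    (-1 : R) ^ i * (-1) ^ m = 1 := by
  rw [← pow_add, h, pow_mul, neg_one_sq, one_pow]

theorem cont_lin {R : Type*} [CommRing R] (l : List R) : ∀ a b : R,
    (l.foldl (fun q a => (a * q.1 + q.2, q.1)) (a, b)).1
     = a * (l.foldl (fun q a => (a * q.1 + q.2, q.1)) ((1 : R), (0 : R))).1
      + b * (l.foldl (fun q a => (a * q.1 + q.2, q.1)) ((0 : R), (1 : R))).1 := by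
  induction l with
  | nil => intro a b; simp
  | cons x l ih =>
    intro a b
    simp only [List.foldl_cons]
    rw [ih, ih (x * 1 + 0), ih (x * 0 + 1)]
    ring

theorem cont_cons_cons {R : Type*} [CommRing R] (x y : R) (l : List R) :
    cont (x :: y :: l) = x * cont (y :: l) + cont l := by
  have h := cont_lin (y :: l) x 1
  unfold cont
  rw [List.foldl_cons]
  simp only [mul_one, add_zero]
  rw [h]
  simp

theorem cont_snoc_snoc {R : Type*} [CommRing R] (x y : R) (l : List R) :
    cont (l ++ [y] ++ [x]) = x * cont (l ++ [y]) + cont l := by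
  unfold cont
  simp [List.foldl_append]

theorem cont_reverse {R : Type*} [CommRing R] : ∀ (n : ℕ) (l : List R), l.length ≤ n →
    cont l.reverse = cont l := by
  intro n
  induction n with
  | zero => intro l h; simp at h; simp [h]
  | succ n ih =>
    intro l h
    match l, h with
    | [], _ => simp
    | [x], _ => simp
    | x :: y :: l, h =>
      simp only [List.length_cons] at h
      rw [cont_cons_cons, List.reverse_cons, List.reverse_cons, cont_snoc_snoc,
        ← List.reverse_cons, ih (y :: l) (by simp; omega), ih l (by omega)]

theorem cont_neg {R : Type*} [CommRing R] : ∀ (n : ℕ) (l : List R), l.length ≤ n →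
    cont (l.map (fun x => -x)) = (-1) ^ l.length * cont l := by
  intro n
  induction n with
  | zero => intro l h; simp at h; simp [h]
  | succ n ih =>
    intro l h
    match l, h with
    | [], _ => simp
    | [x], _ => simp [cont]
    | x :: y :: l, h =>
      simp only [List.length_cons] at h
      have h1 := ih (y :: l) (by simp; omega)
      have h2 := ih l (by omega)
      simp only [List.map_cons] at h1 ⊢
      rw [cont_cons_cons, cont_cons_cons, h1, h2]
      simp only [List.length_cons]
      ring

/-- auxiliary sequence with `hh (n+1) * hh n = 1 / n`, shifted: `hh n` is the value at `n + 1`. -/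
def hh (F : Type*) [Field F] : ℕ → F
  | 0 => 1
  | n + 1 => (((n + 1 : ℕ) : F) * hh F n)⁻¹

theorem hh_ne (F : Type*) [Field F] (n : ℕ) (h : ∀ i, 1 ≤ i → i ≤ n → (i : F) ≠ 0) :
    hh F n ≠ 0 := by
  induction n with
  | zero => simp [hh]
  | succ n ih =>
    rw [hh]
    exact inv_ne_zero (mul_ne_zero (h _ (by omega) le_rfl)
      (ih fun i h1 h2 => h i h1 (by omega)))

theorem hh_prod (F : Type*) [Field F] (n : ℕ)
    (h : ∀ i, 1 ≤ i → i ≤ 2 * n + 2 → (i : F) ≠ 0) :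
    hh F (2 * n + 1) * (2 * ((n + 1 : ℕ) : F)) *
      ∏ i ∈ Finset.Icc 1 (n + 1), (1 - (2 * (i : F))⁻¹) = 1 := by
  induction n with
  | zero =>
    have h2 : (2 : F) ≠ 0 := by exact_mod_cast h 2 (by omega) (by omega)
    simp [hh]
    field_simp
    norm_num
  | succ n ih =>
    have ih := ih (fun i h1 h2 => h i h1 (by omega))
    rw [Finset.prod_Icc_succ_top (by omega)]
    have e : hh F (2 * (n + 1) + 1) = (2 * n + 2) * hh F (2 * n + 1) * (2 * n + 3 : F)⁻¹ := by
      rw [show 2 * (n + 1) + 1 = (2 * n + 1) + 1 + 1 by ring, hh, hh]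
      push_cast
      simp only [mul_inv, inv_inv]
      ring
    have h3 : (2 * n + 3 : F) ≠ 0 := by
      have := h (2 * n + 3) (by omega) (by omega)
      exact_mod_cast this
    have h4 : (2 * (n + 2) : F) ≠ 0 := by
      have := h (2 * (n + 2)) (by omega) (by omega)
      exact_mod_cast this
    have e2 : (2 * ((n + 1 + 1 : ℕ) : F)) * (1 - (2 * ((n + 1 + 1 : ℕ) : F))⁻¹) = 2 * n + 3 := by
      push_cast
      rw [show (n : F) + 1 + 1 = n + 2 by ring, mul_sub, mul_inv_cancel₀ h4]
      ring
    calc _ = hh F (2 * (n + 1) + 1) * ((2 * ((n + 1 + 1 : ℕ) : F)) * (1 - (2 * ((n + 1 + 1 : ℕ) : F))⁻¹)) * ∏ i ∈ Finset.Icc 1 (n + 1), (1 - (2 * (i : F))⁻¹) := by ring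
      _ = hh F (2 * n + 1) * (2 * ((n + 1 : ℕ) : F)) * (∏ i ∈ Finset.Icc 1 (n + 1), (1 - (2 * (i : F))⁻¹)) * ((2 * n + 3 : F)⁻¹ * (2 * n + 3)) := by
        rw [e2, e]; push_cast; ring
      _ = 1 := by rw [ih, inv_mul_cancel₀ h3, mul_one]

theorem stmt_13 (p k : ℕ) [Fact (Nat.Prime p)] (hodd : Odd p)
    (hk1 : 1 ≤ k) (hk2 : 2 * k < p)
    (ω : ZMod p)
    (hω : ω = (-1) ^ (k - 1) * ∏ i ∈ Finset.Icc 1 k, (1 - (2 * (i : ZMod p))⁻¹))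
    (w : ℕ → ZMod p)
    (hwne : ∀ i, 1 ≤ i → i ≤ 2 * k → w i ≠ 0)
    (hw1 : w 1 = (2 * (k : ZMod p) - 1) * (2 * (k : ZMod p) * ω)⁻¹)
    (hwrec : ∀ i, 1 ≤ i → i ≤ 2 * k - 1 →
      w (i + 1) * w i =
        (2 * (k : ZMod p) - 2 * (i : ZMod p) - 1) * (2 * (k : ZMod p) - 2 * (i : ZMod p) + 1)
          * ((i : ZMod p) * (2 * (k : ZMod p) - (i : ZMod p)))⁻¹)
    -- the continuants `K_{n,m} = ⟨w_n T, …, w_m T⟩`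
    (K : ℕ → ℕ → Polynomial (ZMod p))
    (hK : ∀ n m, K n m = cont ((List.range (m + 1 - n)).map fun i => C (w (n + i)) * X))
    -- the polynomials `H(V)` for `V = [p, k, j, ε]`
    (H : ℕ → ZMod p → Polynomial (Polynomial (ZMod p)))
    (hH : ∀ j ε, H j ε
      = C (K (j + 2) (2 * k)) * X ^ (p + 1) - C (K (j + 1) (2 * k)) * X ^ p
        + C (C ε) * (C (K 1 j) * X + C (K 1 (j - 1))))
    (j : ℕ) (hj1 : 1 ≤ j) (hj2 : j ≤ 2 * k - 1) (ε : ZMod p) (hε : ε ≠ 0) :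
    -- `X^{p+1}·H(V)(1/X) = ε·(-1)^{j-1}·H(V*)(X)`, where `V* = [p, k, 2k - j, ε⁻¹]`
    (H j ε).reflect (p + 1) = C (C (ε * (-1) ^ (j - 1))) * H (2 * k - j) ε⁻¹ := by
  have hne : ∀ i : ℕ, 1 ≤ i → i ≤ 2 * k → (i : ZMod p) ≠ 0 := by
    intro i h1 h2 h0
    rw [ZMod.natCast_eq_zero_iff] at h0
    exact absurd (Nat.le_of_dvd (by omega) h0) (by omega)
  have hform : ∀ i, i + 1 ≤ 2 * k → w (i + 1) = (-1) ^ (k - 1) *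
      (2 * (k : ZMod p) - 2 * ((i + 1 : ℕ) : ZMod p) + 1) * hh (ZMod p) i
        * hh (ZMod p) (2 * k - 1 - i) := by
    intro i
    induction i with
    | zero =>
      intro _
      obtain ⟨n, rfl⟩ : ∃ n, k = n + 1 := ⟨k - 1, by omega⟩
      have hp := hh_prod (ZMod p) n (fun i h1 h2 => hne i h1 (by omega))
      have hi : (2 * ((n + 1 : ℕ) : ZMod p) * ω)⁻¹ = (-1) ^ n * hh (ZMod p) (2 * n + 1) := by
        apply inv_eq_of_mul_eq_one_left
        rw [hω]
        have : ((-1 : ZMod p) ^ n) * (-1) ^ n = 1 := by rw [← mul_pow]; simp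
        simp only [Nat.add_sub_cancel]
        linear_combination hp + (hh (ZMod p) (2 * n + 1) * (2 * ((n + 1 : ℕ) : ZMod p)) *
          ∏ i ∈ Finset.Icc 1 (n + 1), (1 - (2 * (i : ZMod p))⁻¹)) * this
      rw [zero_add, hw1, hi]
      rw [show 2 * (n + 1) - 1 - 0 = 2 * n + 1 by omega]
      simp only [hh, Nat.add_sub_cancel]
      push_cast
      ring
    | succ i ih =>
      intro hi
      have ih := ih (by omega)
      have hr := hwrec (i + 1) (by omega) (by omega)
      have hn := hwne (i + 1) (by omega) (by omega)
      apply mul_right_cancel₀ hn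
      rw [hr]
      rw [ih] at hn ⊢
      obtain ⟨m, hm⟩ : ∃ m, 2 * k = i + 2 + m := ⟨2 * k - (i + 2), by omega⟩
      have hmk : (2 : ZMod p) * k = i + 2 + m := by exact_mod_cast congrArg (Nat.cast : ℕ → ZMod p) hm
      rw [show 2 * k - 1 - i = m + 1 by omega, show 2 * k - 1 - (i + 1) = m by omega]
      have ha := hh_ne (ZMod p) i (fun a h1 h2 => hne a h1 (by omega))
      have hb := hh_ne (ZMod p) m (fun a h1 h2 => hne a h1 (by omega))
      have e1 : hh (ZMod p) (i + 1) * hh (ZMod p) i = ((i + 1 : ℕ) : ZMod p)⁻¹ := by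
        rw [hh, mul_inv, mul_assoc, inv_mul_cancel₀ ha, mul_one]
      have e2 : hh (ZMod p) (m + 1) * hh (ZMod p) m = ((m + 1 : ℕ) : ZMod p)⁻¹ := by
        rw [hh, mul_inv, mul_assoc, inv_mul_cancel₀ hb, mul_one]
      have e3 : ((-1 : ZMod p) ^ (k - 1)) * (-1) ^ (k - 1) = 1 := by rw [← mul_pow]; simp
      have e4 : 2 * (k : ZMod p) - ((i + 1 : ℕ) : ZMod p) = ((m + 1 : ℕ) : ZMod p) := by
        rw [hmk]; push_cast; ring
      rw [e4, mul_inv, ← e1, ← e2]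
      generalize hh (ZMod p) (i + 1) = a1
      generalize hh (ZMod p) (m + 1) = a2
      push_cast
      linear_combination (-1) * (2 * (k : ZMod p) - 2 * (i + 1) - 1) * (2 * (k : ZMod p) - 2 * (i + 1) + 1) * a1 * hh (ZMod p) i * a2 * hh (ZMod p) m * e3
  have hanti : ∀ a b, a + b + 2 = 2 * k + 1 → w (a + 1) = - w (b + 1) := by
    intro a b hab
    have hc : (2 : ZMod p) * k = a + b + 1 := by
      have h : 2 * k = a + b + 1 := by omega
      exact_mod_cast congrArg (Nat.cast : ℕ → ZMod p) h
    rw [hform a (by omega), hform b (by omega), show 2 * k - 1 - a = b by omega,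
      show 2 * k - 1 - b = a by omega, hc]
    push_cast
    ring
  have hsym : ∀ m n, m + n = 2 * k → K 1 m = (-1) ^ m * K (n + 1) (2 * k) := by
    intro m n hmn
    rw [hK, hK, show m + 1 - 1 = m by omega, show 2 * k + 1 - (n + 1) = m by omega]
    have hneg := cont_neg m ((List.range m).map fun i => C (w (n + 1 + i)) * (X : (ZMod p)[X]))
      (by simp)
    rw [← cont_reverse m _ (by simp)]
    simp only [List.length_map, List.length_range] at hneg
    rw [← hneg]
    congr 1
    apply List.ext_getElem
    · simp
    · intro i h1 h2
      simp at h1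
      simp only [List.getElem_reverse, List.getElem_map, List.getElem_range, List.length_map,
        List.length_range]
      rw [show 1 + (m - 1 - i) = (m - 1 - i) + 1 by omega,
        show n + 1 + i = (n + i) + 1 by omega, hanti (m - 1 - i) (n + i) (by omega)]
      simp
  have s1 := hsym (j - 1) (2 * k - j + 1) (by omega)
  have s2 := hsym j (2 * k - j) (by omega)
  have s3 := hsym (2 * k - j) j (by omega)
  have s4 := hsym (2 * k - j - 1) (j + 1) (by omega)
  have r1 : (H j ε).reflect (p + 1) = C (K (j + 2) (2 * k)) - C (K (j + 1) (2 * k)) * X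
      + C (C ε) * (C (K 1 j) * X ^ p + C (K 1 (j - 1)) * X ^ (p + 1)) := by
    rw [hH]
    have q1 : (C (K (j + 2) (2 * k)) * X ^ (p + 1) : (ZMod p)[X][X]).reflect (p + 1)
       = C (K (j + 2) (2 * k)) := by
      rw [reflect_C_mul_X_pow, revAt_le le_rfl]; simp
    have q2 : (C (K (j + 1) (2 * k)) * X ^ p : (ZMod p)[X][X]).reflect (p + 1)
       = C (K (j + 1) (2 * k)) * X := by
      rw [reflect_C_mul_X_pow, revAt_le (by omega)]; simp
    have q3 : (C (K 1 j) * X : (ZMod p)[X][X]).reflect (p + 1) = C (K 1 j) * X ^ p := by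
      have := reflect_C_mul_X_pow (p + 1) 1 (c := K 1 j)
      rw [pow_one, revAt_le (by omega)] at this
      simpa using this
    rw [reflect_add, reflect_sub, q1, q2, reflect_C_mul, reflect_add, q3, reflect_C]
  rw [r1, hH, show 2 * k - j + 2 = 2 * k - j + 1 + 1 by omega, s1, s2, s3, s4]
  obtain ⟨i, rfl⟩ : ∃ i, j = i + 1 := ⟨j - 1, by omega⟩
  obtain ⟨m, hm⟩ : ∃ m, 2 * k - (i + 1) = m + 1 := ⟨2 * k - (i + 1) - 1, by omega⟩
  have hpar : ((-1 : (ZMod p)[X][X]) ^ i) * (-1) ^ m = 1 := by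
    exact neg_one_aux i m (k - 1) (by omega)
  have hee : (C (C ε) : (ZMod p)[X][X]) * C (C ε⁻¹) = 1 := by
    rw [← C_mul, ← C_mul, mul_inv_cancel₀ hε]; simp
  rw [hm]
  simp only [Nat.add_sub_cancel, C_mul, C_pow, C_neg, C_1, pow_succ]
  linear_combination (-1) * (C (K (i + 1 + 1 + 1) (2 * k)) - C (K (i + 1 + 1) (2 * k)) * X) *
    ((-1) ^ i * (-1) ^ m * hee + hpar)
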